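/- Let (Ω, 𝓕, P) be a probability space with a filtration (𝓕_k)_{k=0,…,K} (K ≥ 1), d ∈ ℕ with d ≥ 1, and Δ > 0. Let Λ ∈ Matrix(d,d,ℝ) be fixed and let ς : ℝ^d → Matrix(d,d,ℝ) be measurable with ς(x) invertible for every x. For each k = 1,…,K let ε_k : Ω → ℝ^d be a standard Gaussian vector that is 𝓕_k-measurable and independent of 𝓕_{k−1}; let Y_k : Ω → ℝ^d and r_k : Ω → ℝ be 𝓕_{k−1}-measurable with r_k, the entries of ς(Y_k), and the entries of ς(Y_k)^{-1} uniformly bounded. Define Σ_Λ(x) := ς(x) Λ Λᵀ ς(x)ᵀ, Υ_k := Δ·(−r_k·𝟙 + ½·diag(Σ_Λ(Y_k))) + √Δ·ς(Y_k) Λ ε_k, the random matrix C_K ∈ Matrix(d,K,ℝ) whose k-th column is (1/√K)·ς(Y_k)^{-1} Υ_k, S_K(y) := ς(y) C_K C_Kᵀ ς(y)ᵀ, and f_Λ(z, x) := ς(x)^{-1}·(−z + ½·diag(Σ_Λ(x)))·(−z + ½·diag(Σ_Λ(x)))ᵀ·(ς(x)^{-1})ᵀ. Then, for every y ∈ ℝ^d,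 the entrywise expectation satisfies E[S_K(y)] = Δ·Σ_Λ(y) + Δ²·ς(y)·( (1/K)·∑_{k=1}^{K} E[f_Λ(r_k·𝟙, Y_k)] )·ς(y)ᵀ. -/

import Mathlib

open MeasureTheory ProbabilityTheory Matrix

lemma measurable_matrix_det {α : Type*} {m : MeasurableSpace α} {n : Type*} [Fintype n]
    [DecidableEq n] {A : α → Matrix n n ℝ} (hA : ∀ i j, Measurable fun x => A x i j) :
    Measurable fun x => (A x).det := by
  simp only [Matrix.det_apply]
  refine Finset.measurable_sum _ fun σ _ => ?_
  exact (Finset.measurable_prod _ fun i _ => hA _ _).const_smul _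

lemma measurable_matrix_inv_apply {α : Type*} {m : MeasurableSpace α} {n : Type*} [Fintype n]
    [DecidableEq n] {A : α → Matrix n n ℝ} (hA : ∀ i j, Measurable fun x => A x i j) (i j : n) :
    Measurable fun x => (A x)⁻¹ i j := by
  simp only [Matrix.inv_def, Ring.inverse_eq_inv', Matrix.smul_apply, Matrix.adjugate_apply,
    smul_eq_mul]
  refine (measurable_matrix_det hA).inv.mul (measurable_matrix_det fun k l => ?_)
  simp only [Matrix.updateRow_apply]
  split_ifs
  · exact measurable_const
  · exact hA k l

lemma measurable_mulVec_drift {α n : Type*} {m : MeasurableSpace α} [Fintype n]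
    (L : Matrix n n ℝ) {A B : α → Matrix n n ℝ} {r : α → ℝ}
    (hA : ∀ i j, Measurable fun x => A x i j) (hB : ∀ i j, Measurable fun x => B x i j)
    (hr : Measurable r) :
    Measurable fun x => B x *ᵥ fun j => -(r x) + (A x * L * Lᵀ * (A x)ᵀ) j j / 2 := by
  refine measurable_pi_lambda _ fun a => ?_
  simp only [Matrix.mulVec, dotProduct, Matrix.mul_apply, Matrix.transpose_apply]
  fun_prop

lemma memLp_top_mulVec_drift {α n : Type*} {m : MeasurableSpace α} {P : Measure α} [Fintype n]
    (L : Matrix n n ℝ) {A B : α → Matrix n n ℝ} {r : α → ℝ}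
    (hA : ∀ i j, MemLp (fun x => A x i j) ⊤ P) (hB : ∀ i j, MemLp (fun x => B x i j) ⊤ P)
    (hr : MemLp r ⊤ P) (a : n) :
    MemLp (fun x => (B x *ᵥ fun j => -(r x) + (A x * L * Lᵀ * (A x)ᵀ) j j / 2) a) ⊤ P := by
  have hmul {f f' : α → ℝ} (hf : MemLp f ⊤ P) (hf' : MemLp f' ⊤ P) :
      MemLp (fun x => f x * f' x) ⊤ P := hf'.mul hf
  have hconst {f : α → ℝ} (hf : MemLp f ⊤ P) (c : ℝ) : MemLp (fun x => f x * c) ⊤ P :=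
    hf.mul_const c
  simp only [Matrix.mulVec, dotProduct, Matrix.mul_apply, Matrix.transpose_apply, div_eq_mul_inv]
  refine memLp_finsetSum _ fun j _ => hmul (hB a j) (hr.neg.add (hconst ?_ _))
  refine memLp_finsetSum _ fun i _ => hmul ?_ (hA j i)
  refine memLp_finsetSum _ fun l _ => hconst ?_ _
  exact memLp_finsetSum _ fun l _ => hconst (hA j l) _

section StandardGaussian

variable {Ω ι : Type*} {mΩ : MeasurableSpace Ω} {P : Measure Ω} [Fintype ι]
  {X : Ω → ι → ℝ}

lemma map_apply_of_map_eq_pi_gaussianReal (hX : Measurable X)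
    (hlaw : P.map X = Measure.pi fun _ : ι => gaussianReal 0 1) (i : ι) :
    P.map (fun ω => X ω i) = gaussianReal 0 1 := by
  have h := (measurePreserving_eval (fun _ : ι => gaussianReal 0 1) i).map_eq
  rw [← hlaw, Measure.map_map (measurable_pi_apply i) hX] at h
  exact h

lemma memLp_two_of_map_eq_pi_gaussianReal (hX : Measurable X)
    (hlaw : P.map X = Measure.pi fun _ : ι => gaussianReal 0 1) (i : ι) :
    MemLp (fun ω => X ω i) 2 P := by
  have h : MemLp id 2 (P.map fun ω => X ω i) := by
    rw [map_apply_of_map_eq_pi_gaussianReal hX hlaw i]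
    exact memLp_id_gaussianReal 2
  exact h.comp_of_map (measurable_pi_iff.1 hX i).aemeasurable

lemma integral_apply_of_map_eq_pi_gaussianReal (hX : Measurable X)
    (hlaw : P.map X = Measure.pi fun _ : ι => gaussianReal 0 1) (i : ι) :
    ∫ ω, X ω i ∂P = 0 := by
  have h := integral_map (μ := P) (measurable_pi_iff.1 hX i).aemeasurable
    (f := fun x : ℝ => x) (by fun_prop)
  rw [← h, map_apply_of_map_eq_pi_gaussianReal hX hlaw i, integral_id_gaussianReal]

lemma integral_mul_of_map_eq_pi_gaussianReal [DecidableEq ι] [IsProbabilityMeasure P]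
    (hX : Measurable X)
    (hlaw : P.map X = Measure.pi fun _ : ι => gaussianReal 0 1) (i j : ι) :
    ∫ ω, X ω i * X ω j ∂P = if i = j then 1 else 0 := by
  have hXi := measurable_pi_iff.1 hX
  split_ifs with hij
  · subst hij
    have h := variance_of_integral_eq_zero (hXi i).aemeasurable
      (integral_apply_of_map_eq_pi_gaussianReal hX hlaw i)
    have h' := variance_map (μ := P) (X := fun x : ℝ => x) (Y := fun ω => X ω i)
      (by fun_prop) (hXi i).aemeasurable
    rw [map_apply_of_map_eq_pi_gaussianReal hX hlaw i, variance_fun_id_gaussianReal] at h'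
    simp only [← pow_two]
    rw [← h]
    exact h'.symm
  · have hind : iIndepFun (fun i ω => X ω i) P := by
      rw [iIndepFun_iff_map_fun_eq_pi_map fun i => (hXi i).aemeasurable]
      simp only [map_apply_of_map_eq_pi_gaussianReal hX hlaw]
      exact hlaw
    rw [(hind.indepFun hij).integral_fun_mul_eq_mul_integral
      (hXi i).aestronglyMeasurable (hXi j).aestronglyMeasurable,
      integral_apply_of_map_eq_pi_gaussianReal hX hlaw, zero_mul]

lemma memLp_two_mulVec_of_map_eq_pi_gaussianReal (hX : Measurable X)
    (hlaw : P.map X = Measure.pi fun _ : ι => gaussianReal 0 1) (L : Matrix ι ι ℝ) (a : ι) :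
    MemLp (fun ω => (L *ᵥ X ω) a) 2 P := by
  simp only [Matrix.mulVec, dotProduct]
  exact memLp_finsetSum _ fun i _ =>
    (memLp_two_of_map_eq_pi_gaussianReal hX hlaw i).const_mul _

lemma integral_mulVec_of_map_eq_pi_gaussianReal [IsProbabilityMeasure P] (hX : Measurable X)
    (hlaw : P.map X = Measure.pi fun _ : ι => gaussianReal 0 1) (L : Matrix ι ι ℝ) (a : ι) :
    ∫ ω, (L *ᵥ X ω) a ∂P = 0 := by
  simp only [Matrix.mulVec, dotProduct]
  rw [integral_finsetSum _ fun i _ =>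
    ((memLp_two_of_map_eq_pi_gaussianReal hX hlaw i).integrable one_le_two).const_mul _]
  simp [integral_const_mul, integral_apply_of_map_eq_pi_gaussianReal hX hlaw]

lemma integral_mulVec_mul_mulVec_of_map_eq_pi_gaussianReal [IsProbabilityMeasure P]
    (hX : Measurable X) (hlaw : P.map X = Measure.pi fun _ : ι => gaussianReal 0 1)
    (L : Matrix ι ι ℝ) (a b : ι) :
    ∫ ω, (L *ᵥ X ω) a * (L *ᵥ X ω) b ∂P = (L * Lᵀ) a b := by
  classical
  have hint (i j : ι) : Integrable (fun ω => L a i * X ω i * (L b j * X ω j)) P :=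
    ((memLp_two_of_map_eq_pi_gaussianReal hX hlaw i).const_mul _).integrable_mul
      ((memLp_two_of_map_eq_pi_gaussianReal hX hlaw j).const_mul _)
  simp only [Matrix.mulVec, dotProduct, Finset.sum_mul_sum]
  rw [integral_finsetSum _ fun i _ => integrable_finsetSum _ fun j _ => hint i j]
  have hterm (i j : ι) : ∫ ω, L a i * X ω i * (L b j * X ω j) ∂P
      = L a i * L b j * if i = j then 1 else 0 := by
    rw [← integral_mul_of_map_eq_pi_gaussianReal hX hlaw, ← integral_const_mul]
    exact integral_congr_ae (ae_of_all _ fun ω => mul_mul_mul_comm _ _ _ _)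
  simp [integral_finsetSum _ fun j _ => hint _ j, hterm, Matrix.mul_apply]

/-- The second moments of `s g + t L X`, where `X` is a standard Gaussian vector and `g` is
square integrable and independent of `X`. -/
lemma integral_affine_mul_affine_of_map_eq_pi_gaussianReal [IsProbabilityMeasure P]
    (hX : Measurable X) (hlaw : P.map X = Measure.pi fun _ : ι => gaussianReal 0 1)
    (L : Matrix ι ι ℝ) {g : Ω → ι → ℝ} (hg : ∀ a, MemLp (fun ω => g ω a) 2 P)
    (hind : IndepFun X g P) (s t : ℝ) (a b : ι) :
    Integrable (fun ω =>
        (s * g ω a + t * (L *ᵥ X ω) a) * (s * g ω b + t * (L *ᵥ X ω) b)) P ∧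
      ∫ ω, (s * g ω a + t * (L *ᵥ X ω) a) * (s * g ω b + t * (L *ᵥ X ω) b) ∂P
        = s ^ 2 * ∫ ω, g ω a * g ω b ∂P + t ^ 2 * (L * Lᵀ) a b := by
  have hW := memLp_two_mulVec_of_map_eq_pi_gaussianReal hX hlaw L
  have hcross (a b : ι) : ∫ ω, (L *ᵥ X ω) a * g ω b ∂P = 0 := by
    have hm : Measurable fun x : ι → ℝ => (L *ᵥ x) a := by
      simp only [Matrix.mulVec, dotProduct]
      fun_prop
    have h : IndepFun (fun ω => (L *ᵥ X ω) a) (fun ω => g ω b) P :=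
      hind.comp hm (measurable_pi_apply b)
    rw [h.integral_fun_mul_eq_mul_integral (hW a).1 (hg b).1,
      integral_mulVec_of_map_eq_pi_gaussianReal hX hlaw, zero_mul]
  have h1 : Integrable (fun ω => s ^ 2 * (g ω a * g ω b)) P :=
    ((hg a).integrable_mul (hg b)).const_mul _
  have h2 : Integrable (fun ω => t ^ 2 * ((L *ᵥ X ω) a * (L *ᵥ X ω) b)) P :=
    ((hW a).integrable_mul (hW b)).const_mul _
  have h3 : Integrable (fun ω => s * t * ((L *ᵥ X ω) a * g ω b)) P :=
    ((hW a).integrable_mul (hg b)).const_mul _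
  have h4 : Integrable (fun ω => s * t * ((L *ᵥ X ω) b * g ω a)) P :=
    ((hW b).integrable_mul (hg a)).const_mul _
  have hexp : (fun ω => (s * g ω a + t * (L *ᵥ X ω) a) * (s * g ω b + t * (L *ᵥ X ω) b))
      = fun ω => (s ^ 2 * (g ω a * g ω b) + t ^ 2 * ((L *ᵥ X ω) a * (L *ᵥ X ω) b))
        + (s * t * ((L *ᵥ X ω) a * g ω b) + s * t * ((L *ᵥ X ω) b * g ω a)) := by
    funext ω
    ring
  rw [hexp]
  refine ⟨(h1.add h2).add (h3.add h4), ?_⟩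
  rw [integral_add (by exact h1.add h2) (by exact h3.add h4), integral_add h1 h2,
    integral_add h3 h4]
  simp only [integral_const_mul, hcross,
    integral_mulVec_mul_mulVec_of_map_eq_pi_gaussianReal hX hlaw]
  ring

end StandardGaussian

/-- The entrywise integral commutes with multiplication by constant matrices. -/
lemma integral_mul_mul_apply {Ω l m n o : Type*} {mΩ : MeasurableSpace Ω} {P : Measure Ω}
    [Fintype m] [Fintype n] (A : Matrix l m ℝ) (B : Matrix n o ℝ) {M : Ω → Matrix m n ℝ}
    (hM : ∀ a b, Integrable (fun ω => M ω a b) P) (i : l) (j : o) :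
    ∫ ω, (A * M ω * B) i j ∂P = (A * (Matrix.of fun a b => ∫ ω, M ω a b ∂P) * B) i j := by
  simp only [Matrix.mul_apply, Matrix.of_apply]
  rw [integral_finsetSum _ fun b _ =>
    (integrable_finsetSum _ fun a _ => (hM a b).const_mul _).mul_const _]
  refine Finset.sum_congr rfl fun b _ => ?_
  rw [integral_mul_const, integral_finsetSum _ fun a _ => (hM a b).const_mul _]
  simp only [integral_const_mul]

/-- Theorem 4.1 of the paper: exact bias of the volatility estimator `S_K(y)`.
Under Model Assumptions (scaled yield increments `Υ_k` driven by standard Gaussian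
innovations `ε_k` independent of `𝓕_{k−1}`, previsible `Y_k, r_k`), the entrywise
expectation of `S_K(y) = ς(y) C_K C_Kᵀ ς(y)ᵀ` equals
`Δ·Σ_Λ(y) + Δ²·ς(y)·((1/K)·∑ₖ E[f_Λ(r_k·𝟙, Y_k)])·ς(y)ᵀ`. -/
theorem consistent_yield_estimator_bias
    {Ω : Type*} {mΩ : MeasurableSpace Ω} (P : Measure Ω) [IsProbabilityMeasure P]
    (K : ℕ) (hK : 1 ≤ K) (d : ℕ) (hd : 1 ≤ d) (Δ : ℝ) (hΔ : 0 < Δ)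
    (𝓕 : ℕ → MeasurableSpace Ω) (h𝓕_mono : Monotone 𝓕) (h𝓕_le : ∀ k, 𝓕 k ≤ mΩ)
    (L : Matrix (Fin d) (Fin d) ℝ)
    (ς : (Fin d → ℝ) → Matrix (Fin d) (Fin d) ℝ)
    (hς_meas : ∀ i j, Measurable fun x => ς x i j)
    (hς_inv : ∀ x, IsUnit (ς x).det)
    (ε : ℕ → Ω → (Fin d → ℝ))
    (hε_meas : ∀ k ∈ Finset.Icc 1 K, Measurable[𝓕 k] (ε k))
    (hε_law : ∀ k ∈ Finset.Icc 1 K,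
      @Measure.map Ω (Fin d → ℝ) mΩ _ (ε k) P
        = Measure.pi (fun _ : Fin d => gaussianReal 0 1))
    (hε_indep : ∀ k ∈ Finset.Icc 1 K,
      Indep (MeasurableSpace.comap (ε k) inferInstance) (𝓕 (k - 1)) P)
    (Y : ℕ → Ω → (Fin d → ℝ)) (r : ℕ → Ω → ℝ)
    (hY_meas : ∀ k ∈ Finset.Icc 1 K, Measurable[𝓕 (k - 1)] (Y k))
    (hr_meas : ∀ k ∈ Finset.Icc 1 K, Measurable[𝓕 (k - 1)] (r k))
    (Cb : ℝ)
    (h_bd : ∀ k ∈ Finset.Icc 1 K, ∀ ω, |r k ω| ≤ Cb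
      ∧ (∀ i j, |ς (Y k ω) i j| ≤ Cb) ∧ (∀ i j, |(ς (Y k ω))⁻¹ i j| ≤ Cb))
    (SgL : (Fin d → ℝ) → Matrix (Fin d) (Fin d) ℝ)
    (hSgL : ∀ x, SgL x = ς x * L * Lᵀ * (ς x)ᵀ)
    (Υ : ℕ → Ω → (Fin d → ℝ))
    (hΥ : ∀ k ∈ Finset.Icc 1 K, ∀ ω, ∀ j, Υ k ω j
      = Δ * (-(r k ω) + SgL (Y k ω) j j / 2) + Real.sqrt Δ * ((ς (Y k ω) * L) *ᵥ ε k ω) j)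
    (CK : Ω → Matrix (Fin d) (Fin K) ℝ)
    (hCK : ∀ ω, ∀ i, ∀ k : Fin K,
      CK ω i k = (Real.sqrt K)⁻¹ * ((ς (Y ((k : ℕ) + 1) ω))⁻¹ *ᵥ Υ ((k : ℕ) + 1) ω) i)
    (S : Ω → (Fin d → ℝ) → Matrix (Fin d) (Fin d) ℝ)
    (hS : ∀ ω y, S ω y = ς y * (CK ω * (CK ω)ᵀ) * (ς y)ᵀ)
    (fL : (Fin d → ℝ) → (Fin d → ℝ) → Matrix (Fin d) (Fin d) ℝ)
    (hfL : ∀ z x, fL z x = (ς x)⁻¹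
      * vecMulVec (fun j => -z j + SgL x j j / 2) (fun j => -z j + SgL x j j / 2)
      * ((ς x)⁻¹)ᵀ)
    (y : Fin d → ℝ) :
    (Matrix.of fun i j => ∫ ω, S ω y i j ∂P)
      = Δ • SgL y + Δ ^ 2 •
        (ς y * (Matrix.of fun a b =>
            (K : ℝ)⁻¹ * ∑ k ∈ Finset.Icc 1 K,
              ∫ ω, fL (fun _ => r k ω) (Y k ω) a b ∂P) * (ς y)ᵀ) := by
  set g : ℕ → Ω → Fin d → ℝ := fun k ω =>
    (ς (Y k ω))⁻¹ *ᵥ fun j => -(r k ω) + SgL (Y k ω) j j / 2 with hg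
  have hςY {k} (hk : k ∈ Finset.Icc 1 K) (i j : Fin d) :
      Measurable[𝓕 (k - 1)] fun ω => ς (Y k ω) i j :=
    (hς_meas i j).comp (hY_meas k hk)
  have hςY' {k} (hk : k ∈ Finset.Icc 1 K) (i j : Fin d) :
      Measurable[𝓕 (k - 1)] fun ω => (ς (Y k ω))⁻¹ i j :=
    (measurable_matrix_inv_apply hς_meas i j).comp (hY_meas k hk)
  have hg_meas {k} (hk : k ∈ Finset.Icc 1 K) : Measurable[𝓕 (k - 1)] (g k) := by
    simp only [hg, hSgL]
    exact measurable_mulVec_drift L (hςY hk) (hςY' hk) (hr_meas k hk)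
  have hg_memLp {k} (hk : k ∈ Finset.Icc 1 K) (a : Fin d) :
      MemLp (fun ω => g k ω a) 2 P := by
    have hbdd {f : Ω → ℝ} (hf : Measurable[𝓕 (k - 1)] f) (hb : ∀ ω, |f ω| ≤ Cb) :
        MemLp f ⊤ P :=
      memLp_top_of_bound (hf.mono (h𝓕_le _) le_rfl).aestronglyMeasurable Cb (ae_of_all _ hb)
    have h1 (i j) := hbdd (hςY hk i j) fun ω => (h_bd k hk ω).2.1 i j
    have h2 (i j) := hbdd (hςY' hk i j) fun ω => (h_bd k hk ω).2.2 i j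
    have h3 := hbdd (hr_meas k hk) fun ω => (h_bd k hk ω).1
    simp only [hg, hSgL]
    exact (memLp_top_mulVec_drift L h1 h2 h3 a).mono_exponent le_top
  have hΥg {k} (hk : k ∈ Finset.Icc 1 K) (ω : Ω) (i : Fin d) :
      ((ς (Y k ω))⁻¹ *ᵥ Υ k ω) i = Δ * g k ω i + √Δ * (L *ᵥ ε k ω) i := by
    have h : Υ k ω = Δ • (fun j => -(r k ω) + SgL (Y k ω) j j / 2)
        + √Δ • ((ς (Y k ω) * L) *ᵥ ε k ω) := by
      ext j
      simpa using hΥ k hk ω j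
    rw [h, Matrix.mulVec_add, Matrix.mulVec_smul, Matrix.mulVec_smul, Matrix.mulVec_mulVec,
      Matrix.nonsing_inv_mul_cancel_left _ _ (hς_inv _)]
    simp [hg]
  have hfLg (k : ℕ) (ω : Ω) (a b : Fin d) :
      fL (fun _ => r k ω) (Y k ω) a b = g k ω a * g k ω b := by
    rw [hfL, Matrix.mul_vecMulVec, Matrix.vecMulVec_mul, Matrix.vecMul_transpose,
      Matrix.vecMulVec_apply]
  have hCC (ω : Ω) (a b : Fin d) : (CK ω * (CK ω)ᵀ) a b = (K : ℝ)⁻¹ * ∑ k ∈ Finset.Icc 1 K,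
      (Δ * g k ω a + √Δ * (L *ᵥ ε k ω) a) * (Δ * g k ω b + √Δ * (L *ᵥ ε k ω) b) := by
    have hsq : (√(K : ℝ))⁻¹ * (√(K : ℝ))⁻¹ = (K : ℝ)⁻¹ := by
      rw [← mul_inv, Real.mul_self_sqrt (Nat.cast_nonneg K)]
    have hIcc : Finset.Icc 1 K = Finset.Ico 1 (K + 1) := by
      ext
      simp
    rw [Matrix.mul_apply, hIcc, Finset.sum_Ico_eq_sum_range, Nat.add_sub_cancel,
      ← Fin.sum_univ_eq_sum_range (fun k =>
        (Δ * g (1 + k) ω a + √Δ * (L *ᵥ ε (1 + k) ω) a)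
          * (Δ * g (1 + k) ω b + √Δ * (L *ᵥ ε (1 + k) ω) b)) K, Finset.mul_sum]
    refine Finset.sum_congr rfl fun k _ => ?_
    have hk : (k : ℕ) + 1 ∈ Finset.Icc 1 K := Finset.mem_Icc.2 ⟨by omega, k.2⟩
    rw [Matrix.transpose_apply, hCK, hCK, hΥg hk, hΥg hk, mul_mul_mul_comm, hsq, add_comm 1]
  have hind {k} (hk : k ∈ Finset.Icc 1 K) : IndepFun (ε k) (g k) P :=
    (IndepFun_iff_Indep _ _ _).2
      (indep_of_indep_of_le_right (hε_indep k hk) (hg_meas hk).comap_le)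
  have hmoment {k} (hk : k ∈ Finset.Icc 1 K) (a b : Fin d) :=
    integral_affine_mul_affine_of_map_eq_pi_gaussianReal
      ((hε_meas k hk).mono (h𝓕_le k) le_rfl) (hε_law k hk) L (hg_memLp hk)
      (hind hk) Δ (√Δ) a b
  have hint (a b : Fin d) : Integrable (fun ω => (CK ω * (CK ω)ᵀ) a b) P := by
    simp only [hCC]
    exact (integrable_finsetSum _ fun k hk => (hmoment hk a b).1).const_mul _
  have hECC : (Matrix.of fun a b => ∫ ω, (CK ω * (CK ω)ᵀ) a b ∂P)
      = Δ • (L * Lᵀ) + Δ ^ 2 • Matrix.of fun a b => (K : ℝ)⁻¹ * ∑ k ∈ Finset.Icc 1 K,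
          ∫ ω, fL (fun _ => r k ω) (Y k ω) a b ∂P := by
    have hK0 : (K : ℝ) ≠ 0 := Nat.cast_ne_zero.2 (by omega)
    ext a b
    simp only [Matrix.of_apply, hCC, hfLg, Matrix.add_apply, Matrix.smul_apply, smul_eq_mul]
    rw [integral_const_mul, integral_finsetSum _ fun k hk => (hmoment hk a b).1,
      Finset.sum_congr rfl fun k hk => (hmoment hk a b).2, Finset.sum_add_distrib,
      ← Finset.mul_sum, Real.sq_sqrt hΔ.le, Finset.sum_const, Nat.card_Icc, Nat.add_sub_cancel,
      nsmul_eq_mul]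
    field_simp
    ring
  have hES : (Matrix.of fun i j => ∫ ω, S ω y i j ∂P)
      = ς y * (Matrix.of fun a b => ∫ ω, (CK ω * (CK ω)ᵀ) a b ∂P) * (ς y)ᵀ := by
    ext i j
    simp only [Matrix.of_apply, hS]
    exact integral_mul_mul_apply (ς y) (ς y)ᵀ hint i j
  rw [hES, hECC, hSgL, Matrix.mul_add, Matrix.add_mul, Matrix.mul_smul, Matrix.smul_mul,
    Matrix.mul_smul, Matrix.smul_mul, Matrix.mul_assoc (ς y) L]
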